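/- Let N be a positive integer and let χ_{i,j} : Γ → kˣ (1 ≤ i < j ≤ n+1) be group homomorphisms with χ_{i,j} = χ_{i,p}·χ_{p,j} for all i < p < j. Let γ = (γ_{i,j})_{1≤i<j≤n+1} be a family of scalars in k with γ_{i,j} = 0 whenever h_{i,j} = 1, and define u_{i,j} ∈ kΓ recursively by u_{i,j} = γ_{i,j}·(1 − h_{i,j}) + Σ_{i<p<j} C^j_{i,p}·γ_{i,p}·u_{p,j}. Then the following are equivalent: (a) for all i < j, u_{i,j} = 0 whenever χ_{i,j}^N is not the trivial character; (b) for all i < j, γ_{i,j} = 0 whenever χ_{i,j}^N is not the trivial character. (Lemma 'centraluij', part 1.) -/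

import Mathlib

/-- The elements `u_{i,j}(γ) ∈ kΓ`, defined by induction on `j − i` by
`u_{i,j}(γ) = γ_{i,j}·(1 − h_{i,j}) + Σ_{i<p<j} C^j_{i,p}·γ_{i,p}·u_{p,j}(γ)`. -/
noncomputable def uu {k Γ : Type*} [Field k] [CommGroup Γ]
    (h : ℕ → ℕ → Γ) (C : ℕ → ℕ → ℕ → k) (γ : ℕ → ℕ → k) :
    ℕ → ℕ → MonoidAlgebra k Γ
  | i, j =>
    γ i j • ((1 : MonoidAlgebra k Γ) - MonoidAlgebra.of k Γ (h i j))
      + ∑ p ∈ (Finset.Ioo i j).attach,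
          (C j i p.1 * γ i p.1) • uu h C γ p.1 j
  termination_by i j => j - i
  decreasing_by
    have := Finset.mem_Ioo.mp p.2
    omega

/-- If every summand of the recursion has a vanishing factor, then `u_{i,j}(γ)` is its leading
term. -/
lemma uu_eq_smul_of_forall {k Γ : Type*} [Field k] [CommGroup Γ]
    (h : ℕ → ℕ → Γ) (C : ℕ → ℕ → ℕ → k) (γ : ℕ → ℕ → k) (i j : ℕ)
    (hs : ∀ p, i < p → p < j → γ i p = 0 ∨ uu h C γ p j = 0) :
    uu h C γ i j = γ i j • ((1 : MonoidAlgebra k Γ) - MonoidAlgebra.of k Γ (h i j)) := by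
  rw [uu, Finset.sum_eq_zero, add_zero]
  rintro ⟨p, hp⟩ -
  obtain ⟨hip, hpj⟩ := Finset.mem_Ioo.mp hp
  rcases hs p hip hpj with h0 | h0 <;> simp [h0]

/-- Lemma `centraluij`, part 1: for characters `χ_{i,j} : Γ → kˣ` with
`χ_{i,j} = χ_{i,p}·χ_{p,j}`, the vanishing `u_{i,j} = 0` whenever `χ_{i,j}^N ≠ ε`
is equivalent to the vanishing `γ_{i,j} = 0` whenever `χ_{i,j}^N ≠ ε`. -/
theorem centraluij_one {k Γ : Type*} [Field k] [CommGroup Γ] [Fintype Γ]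
    (n : ℕ) (hn : 1 ≤ n) (N : ℕ) (hN : 0 < N)
    (h : ℕ → ℕ → Γ) (C : ℕ → ℕ → ℕ → k)
    (hC0 : ∀ i p j, 1 ≤ i → i < p → p < j → j ≤ n + 1 → C j i p ≠ 0)
    (χ : ℕ → ℕ → (Γ →* kˣ))
    (hχ : ∀ i p j, 1 ≤ i → i < p → p < j → j ≤ n + 1 → χ i j = χ i p * χ p j)
    (γ : ℕ → ℕ → k)
    (hγ : ∀ i j, 1 ≤ i → i < j → j ≤ n + 1 → h i j = 1 → γ i j = 0) :
    (∀ i j, 1 ≤ i → i < j → j ≤ n + 1 → χ i j ^ N ≠ 1 →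
        uu h C γ i j = (0 : MonoidAlgebra k Γ))
    ↔ (∀ i j, 1 ≤ i → i < j → j ≤ n + 1 → χ i j ^ N ≠ 1 → γ i j = 0) := by
  have split : ∀ i p j, 1 ≤ i → i < p → p < j → j ≤ n + 1 → χ i j ^ N ≠ 1 →
      χ i p ^ N ≠ 1 ∨ χ p j ^ N ≠ 1 := by
    intro i p j hi hip hpj hj hne
    by_contra! hc
    rw [hχ i p j hi hip hpj hj] at hne
    exact hne ((mul_pow (χ i p) (χ p j) N).trans (by rw [hc.1, hc.2]; exact one_mul (1 : Γ →* kˣ)))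
  constructor
  · intro hu i j
    induction j using Nat.strong_induction_on with
    | _ j ih =>
      intro hi hij hj hne
      have key := uu_eq_smul_of_forall h C γ i j fun p hip hpj =>
        (split i p j hi hip hpj hj hne).imp
          (ih p hpj hi hip (by omega)) (hu p j (by omega) hpj hj)
      rw [hu i j hi hij hj hne] at key
      rcases smul_eq_zero.mp key.symm with h0 | h0
      · exact h0
      · refine hγ i j hi hij hj (MonoidAlgebra.of_injective (R := k) ?_)
        rw [map_one, sub_eq_zero.mp h0]
  · intro hg i j hi hij hj hne
    induction hd : j - i using Nat.strong_induction_on generalizing i with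
    | _ d ih =>
      rw [uu_eq_smul_of_forall h C γ i j, hg i j hi hij hj hne, zero_smul]
      exact fun p hip hpj => (split i p j hi hip hpj hj hne).imp
        (hg i p hi hip (by omega))
        fun hp => ih (j - p) (by omega) p (by omega) hpj hp rfl
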